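/- arXiv:math/0701544 — 3 statements merged into one kernel-verified Lean document; each statement's English description precedes it below -/
import Mathlib

section
/- Let H be a group containing two finite normal subgroups F and F' such that each of the quotient groups H/F and H/F' is isomorphic either to the infinite cyclic group ℤ or to the infinite dihedral group. Then F = F'. -/
lemma aux_int (N : Subgroup (Multiplicative ℤ)) [Finite N] : N = ⊥ := by
  rw [Subgroup.eq_bot_iff_forall]
  intro x hx
  have h : IsOfFinOrder (⟨x, hx⟩ : N) := isOfFinOrder_of_finite _
  obtain ⟨n, hn, h⟩ := isOfFinOrder_iff_pow_eq_one.1 h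
  have h2 : x ^ n = 1 := congrArg Subtype.val h
  have h3 : (n : ℤ) * x.toAdd = 0 := by
    have := congrArg Multiplicative.toAdd h2
    simpa using this
  have h4 : x.toAdd = 0 := by
    rcases mul_eq_zero.1 h3 with h | h
    · omega
    · exact h
  exact h4

lemma aux_dih (N : Subgroup (DihedralGroup 0)) [hN : N.Normal] [Finite N] : N = ⊥ := by
  have key : ∀ i : ZMod 0, (DihedralGroup.r i : DihedralGroup 0) ∈ N → i = 0 := by
    intro i hx
    have h : IsOfFinOrder (⟨_, hx⟩ : N) := isOfFinOrder_of_finite _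
    obtain ⟨n, hn, h⟩ := isOfFinOrder_iff_pow_eq_one.1 h
    have h2 : (DihedralGroup.r i : DihedralGroup 0) ^ n = 1 := congrArg Subtype.val h
    rw [DihedralGroup.r_pow, DihedralGroup.one_def] at h2
    have h3 : (show ℤ from i) * (n : ℤ) = 0 := DihedralGroup.r.inj h2
    rcases mul_eq_zero.1 h3 with h | h
    · exact h
    · omega
  rw [Subgroup.eq_bot_iff_forall]
  rintro (i | i) hx
  · rw [key i hx]; rfl
  · exfalso
    have h1 := N.mul_mem (hN.conj_mem _ hx (DihedralGroup.r 1)) hx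
    simp only [DihedralGroup.r_mul_sr, DihedralGroup.inv_r, DihedralGroup.sr_mul_r,
      DihedralGroup.sr_mul_sr] at h1
    have h2 := key _ h1
    have h3 : ∀ j : ℤ, j - (j - 1 + -1) ≠ 0 := by intro j; omega
    exact h3 i h2

lemma aux_le {H : Type*} [Group H] (F F' : Subgroup H) [F.Normal] [hn : F'.Normal]
    [Finite F']
    (hF : Nonempty (H ⧸ F ≃* Multiplicative ℤ) ∨ Nonempty (H ⧸ F ≃* DihedralGroup 0)) :
    F' ≤ F := by
  have fin : ∀ {G : Type} [Group G] (f : H →* G), Finite (F'.map f) := fun f =>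
    Set.Finite.image f (Set.toFinite (F' : Set H))
  intro x hx
  rw [← QuotientGroup.eq_one_iff]
  rcases hF with ⟨⟨e⟩⟩ | ⟨⟨e⟩⟩
  · let f := e.toMonoidHom.comp (QuotientGroup.mk' F)
    have := fin f
    have hb := aux_int (F'.map f)
    have : f x ∈ F'.map f := Subgroup.mem_map_of_mem f hx
    rw [hb, Subgroup.mem_bot] at this
    exact (map_eq_one_iff e e.injective).1 this
  · let f := e.toMonoidHom.comp (QuotientGroup.mk' F)
    have := fin f
    have : (F'.map f).Normal :=
      hn.map f (e.surjective.comp (QuotientGroup.mk'_surjective F))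
    have hb := aux_dih (F'.map f)
    have : f x ∈ F'.map f := Subgroup.mem_map_of_mem f hx
    rw [hb, Subgroup.mem_bot] at this
    exact (map_eq_one_iff e e.injective).1 this

/-- Lemma 4 of the paper: if a group `H` has two finite normal subgroups `F` and `F'`
such that each quotient `H ⧸ F`, `H ⧸ F'` is isomorphic to `ℤ` or to the infinite
dihedral group `D∞ = DihedralGroup 0`, then `F = F'`. -/
theorem unique_finite_normal_subgroup_of_quotient_int_or_infiniteDihedral
    {H : Type*} [Group H] (F F' : Subgroup H) [F.Normal] [F'.Normal]
    [Finite F] [Finite F']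
    (hF : Nonempty (H ⧸ F ≃* Multiplicative ℤ) ∨ Nonempty (H ⧸ F ≃* DihedralGroup 0))
    (hF' : Nonempty (H ⧸ F' ≃* Multiplicative ℤ) ∨ Nonempty (H ⧸ F' ≃* DihedralGroup 0)) :
    F = F' := by
  exact le_antisymm (aux_le F' F hF') (aux_le F F' hF)
end

section
/- Let N' be a group and N a subgroup of N' of finite index. Suppose F is a finite normal subgroup of N with N/F isomorphic to ℤ or to the infinite dihedral group, and F' is a finite normal subgroup of N' with N'/F' isomorphic to ℤ or to the infinite dihedral group. Then F ⊆ F'. -/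
/-- If `N` is a finite-index subgroup of `N'`, `F` is a finite normal subgroup of `N`
with `N ⧸ F` isomorphic to `ℤ` or to the infinite dihedral group, and `F'` is a finite
normal subgroup of `N'` with `N' ⧸ F'` isomorphic to `ℤ` or to the infinite dihedral
group, then `F ⊆ F'`. -/
theorem finite_normal_subgroup_le_of_finiteIndex
    {N' : Type*} [Group N'] (N : Subgroup N') [N.FiniteIndex]
    (F : Subgroup ↥N) [F.Normal] [Finite F]
    (F' : Subgroup N') [F'.Normal] [Finite F']
    (hF : Nonempty (↥N ⧸ F ≃* Multiplicative ℤ) ∨ Nonempty (↥N ⧸ F ≃* DihedralGroup 0))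
    (hF' : Nonempty (N' ⧸ F' ≃* Multiplicative ℤ) ∨ Nonempty (N' ⧸ F' ≃* DihedralGroup 0)) :
    F.map N.subtype ≤ F' := by
  have key0 : ∀ (j : ℤ) (n : ℕ), 0 < n → j * (n : ℤ) = 0 → j = 0 := by
    intro j n hn h
    rcases mul_eq_zero.mp h with h | h
    · exact h
    · omega
  have key : ∀ (j : ℤ) (k a b : ℕ), j - (k : ℤ) * (a : ℤ) - (k : ℤ) * (a : ℤ)
      = j - (k : ℤ) * (b : ℤ) - (k : ℤ) * (b : ℤ) → k * a = k * b := by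
    intro j k a b h
    have h4 : (k : ℤ) * (a : ℤ) = (k : ℤ) * (b : ℤ) := by linarith
    exact_mod_cast h4
  rintro _ ⟨x, hx, rfl⟩
  have hfin : IsOfFinOrder (x : N') := by
    have h1 : IsOfFinOrder (⟨x, hx⟩ : F) := isOfFinOrder_of_finite _
    exact (N.subtype.comp F.subtype).isOfFinOrder h1
  change (x : N') ∈ F'
  rw [← QuotientGroup.eq_one_iff]
  rcases hF' with ⟨⟨e⟩⟩ | ⟨⟨e⟩⟩
  · have h2 := (e.toMonoidHom.comp (QuotientGroup.mk' F')).isOfFinOrder hfin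
    obtain ⟨n, hn, h⟩ := isOfFinOrder_iff_pow_eq_one.mp h2
    have h3 : (e.toMonoidHom.comp (QuotientGroup.mk' F')) x = 1 := by
      have h5 := congrArg Multiplicative.toAdd h
      rw [toAdd_pow, nsmul_eq_mul, mul_comm] at h5
      exact key0 _ n hn h5
    exact e.injective (h3.trans (map_one e).symm)
  · let f : N' →* DihedralGroup 0 := e.toMonoidHom.comp (QuotientGroup.mk' F')
    have hf : Function.Surjective f := e.surjective.comp (QuotientGroup.mk'_surjective F')
    have h2 : IsOfFinOrder (f x) := f.isOfFinOrder hfin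
    suffices h3 : f x = 1 from e.injective (h3.trans (map_one e).symm)
    rcases hq : f x with i | i
    · rw [hq] at h2
      obtain ⟨n, hn, h⟩ := isOfFinOrder_iff_pow_eq_one.mp h2
      rw [DihedralGroup.r_pow, DihedralGroup.one_def, DihedralGroup.r.injEq] at h
      rw [DihedralGroup.one_def, DihedralGroup.r.injEq]
      exact key0 i n hn h
    · exfalso
      obtain ⟨g, hg⟩ := hf (DihedralGroup.r 1)
      obtain ⟨k, hk, -, hgk⟩ :=
        Subgroup.exists_pow_mem_of_index_ne_zero (H := N) Subgroup.FiniteIndex.index_ne_zero g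
      let y : N := ⟨g ^ k, hgk⟩
      let c : ℕ → F := fun m =>
        ⟨y ^ m * x * (y ^ m)⁻¹, Subgroup.Normal.conj_mem inferInstance x hx _⟩
      have hc : ∀ m, f ((c m : N) : N') = DihedralGroup.sr (i - (k : ZMod 0) * (m : ZMod 0) - (k : ZMod 0) * (m : ZMod 0)) := by
        intro m
        simp [c, y, hq, hg, sub_eq_add_neg]
      refine not_injective_infinite_finite c ?_
      intro a b hab
      have h := (hc a).symm.trans ((congrArg (fun z : F => f ((z : N) : N')) hab).trans (hc b))
      rw [DihedralGroup.sr.injEq] at h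
      exact Nat.eq_of_mul_eq_mul_left hk (key i k a b h)
end

section
/- Let G be a group acting on a set V such that the action preserves the adjacency relation of a simple graph τ on V (for all g ∈ G and u, w ∈ V, u and w are adjacent if and only if g•u and g•w are adjacent), and suppose τ is a tree (connected and acyclic). Let v₁, …, vₙ ∈ V, let Vᵢ = {g ∈ G : g•vᵢ = vᵢ} be their stabilizers, and let H be the subgroup of G generated by V₁ ∪ ⋯ ∪ Vₙ. If S₀ ⊆ V is a set of vertices containing v₁, …, vₙ whose induced subgraph in τ is connected, then the induced subgraph of τ on the union ⋃_{g ∈ H} g•S₀ is connected. -/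
open Pointwise

/-- Lemma 7 of the paper: let a group `G` act on the vertices of a tree `τ`, preserving
adjacency.  Let `v₁, …, vₙ` be vertices with stabilizers `V₁, …, Vₙ`, and let `H` be the
subgroup generated by `V₁ ∪ ⋯ ∪ Vₙ`.  If `S₀` is a set of vertices containing
`v₁, …, vₙ` whose induced subgraph is connected, then the induced subgraph on the union
of the `H`-translates of `S₀` is connected. -/
theorem induce_orbit_connected
    {G V : Type*} [Group G] [MulAction G V] (τ : SimpleGraph V)
    (hact : ∀ (g : G) (u w : V), τ.Adj u w ↔ τ.Adj (g • u) (g • w))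
    (htree : τ.IsTree) {n : ℕ} (v : Fin n → V)
    (H : Subgroup G) (hH : H = ⨆ i, MulAction.stabilizer G (v i))
    (S₀ : Set V) (hv : ∀ i, v i ∈ S₀) (hconn : (τ.induce S₀).Connected) :
    (τ.induce (⋃ g ∈ (H : Set G), g • S₀)).Connected := by
  have mem : ∀ g ∈ H, ∀ x ∈ S₀, g • x ∈ (⋃ g ∈ (H : Set G), g • S₀) := by
    intro g hg x hx
    exact Set.mem_biUnion (show g ∈ (H : Set G) from hg) (Set.smul_mem_smul_set hx)
  have mem' : ∀ g ∈ H, ∀ x ∈ (⋃ g ∈ (H : Set G), g • S₀),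
      g • x ∈ (⋃ g ∈ (H : Set G), g • S₀) := by
    intro g hg x hx
    simp only [Set.mem_iUnion] at hx
    obtain ⟨k, hk, y, hy, rfl⟩ := hx
    have := mem (g * k) (H.mul_mem hg hk) y hy
    rwa [mul_smul] at this
  have mem1 : ∀ x ∈ S₀, x ∈ (⋃ g ∈ (H : Set G), g • S₀) := by
    intro x hx
    have := mem 1 H.one_mem x hx
    rwa [one_smul] at this
  generalize hU : (⋃ g ∈ (H : Set G), g • S₀) = U at *
  let R : V → V → Prop := fun x y => ∃ (hx : x ∈ U) (hy : y ∈ U),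
    (τ.induce U).Reachable ⟨x, hx⟩ ⟨y, hy⟩
  have Rsymm : ∀ {x y}, R x y → R y x := fun ⟨hx, hy, h⟩ => ⟨hy, hx, h.symm⟩
  have Rtrans : ∀ {x y z}, R x y → R y z → R x z :=
    fun ⟨hx, _, h⟩ ⟨_, hz, h'⟩ => ⟨hx, hz, h.trans h'⟩
  have Rsmul : ∀ g ∈ H, ∀ {x y}, R x y → R (g • x) (g • y) := by
    rintro g hg x y ⟨hx, hy, h⟩
    let f : τ.induce U →g τ.induce U :=
      ⟨fun a => ⟨g • a.1, mem' g hg a.1 a.2⟩, fun {a b} hab => (hact g a.1 b.1).1 hab⟩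
    exact ⟨mem' g hg x hx, mem' g hg y hy, h.map f⟩
  have RS : ∀ x ∈ S₀, ∀ y ∈ S₀, R x y := by
    intro x hx y hy
    let f : τ.induce S₀ →g τ.induce U :=
      ⟨fun a => ⟨a.1, mem1 a.1 a.2⟩, fun {a b} hab => hab⟩
    exact ⟨mem1 x hx, mem1 y hy, (hconn.preconnected ⟨x, hx⟩ ⟨y, hy⟩).map f⟩
  obtain ⟨b, hb⟩ := hconn.nonempty
  let K : Subgroup G :=
    { carrier := {g | g ∈ H ∧ R b (g • b)}
      one_mem' := ⟨H.one_mem, by rw [one_smul]; exact RS b hb b hb⟩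
      mul_mem' := by
        rintro g k ⟨hg, hg'⟩ ⟨hk, hk'⟩
        refine ⟨H.mul_mem hg hk, ?_⟩
        rw [mul_smul]
        exact Rtrans hg' (Rsmul g hg hk')
      inv_mem' := by
        rintro g ⟨hg, hg'⟩
        refine ⟨H.inv_mem hg, ?_⟩
        have := Rsmul g⁻¹ (H.inv_mem hg) hg'
        rw [inv_smul_smul] at this
        exact Rsymm this }
  have hHK : H ≤ K := by
    have : (⨆ i, MulAction.stabilizer G (v i)) ≤ K := by
      refine iSup_le fun i g hg => ?_
      have hgH : g ∈ H := by
        rw [hH]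
        exact (le_iSup (fun i => MulAction.stabilizer G (v i)) i) hg
      refine ⟨hgH, ?_⟩
      have h1 := RS b hb (v i) (hv i)
      have h2 := Rsmul g hgH h1
      rw [MulAction.mem_stabilizer_iff.1 hg] at h2
      exact Rtrans h1 (Rsymm h2)
    exact hH.le.trans this
  rw [SimpleGraph.connected_iff_exists_forall_reachable]
  refine ⟨⟨b, mem1 b hb⟩, ?_⟩
  rintro ⟨x, hx⟩
  have hx' := hx
  rw [← hU] at hx'
  simp only [Set.mem_iUnion] at hx'
  obtain ⟨k, hk, y, hy, rfl⟩ := hx'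
  obtain ⟨_, _, h⟩ := Rtrans (hHK hk).2 (Rsmul k hk (RS b hb y hy))
  exact h
end
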